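/- Let ρ ∈ (1/2, 1/√2) and λ = √(4ρ² − 1). Then lim_{δ→0⁺} S(ρ,δ)/(4·δ²·G(ρ,δ)) = (1/(2√2))·(1 − λ − ρ²·(π − 4·arctan λ))⁻¹. Equivalently, since the ball-piston mean free time is τ_bp(ρ,δ) = 4·G(ρ,δ)/S(ρ,δ), the rescaled inverse mean free time (τ_bp(ρ,δ)·δ²)⁻¹ converges as δ → 0⁺ to (1/(2√2))·(1 − λ − ρ²·(π − 4·arctan λ))⁻¹. -/

import Mathlib

open MeasureTheory Real Filter

noncomputable def lam (ρ : ℝ) : ℝ := Real.sqrt (4*ρ^2 - 1)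

/-- Area of the ball cell. -/
noncomputable def A (ρ : ℝ) : ℝ :=
  1 - lam ρ - ρ^2 * (Real.pi - 4 * Real.arctan (lam ρ))

noncomputable def R (ρ δ : ℝ) : ℝ :=
  Real.arctan (lam ρ)
    - Real.arctan ((lam ρ + 2*δ)/Real.sqrt (1 - 4*δ*(lam ρ + δ)))

/-- Volume of the ball-piston configuration space. -/
noncomputable def G (ρ δ : ℝ) : ℝ :=
  (lam ρ + 2*δ) * A ρ
    - (1/24) * (2*δ*(lam ρ + 4*δ)
        + (1 - Real.sqrt (1 - 4*δ*(lam ρ + δ)))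
            * (2 + 4*δ*(lam ρ + δ) + 3*(lam ρ)^2))
    - (1/2) * ρ^2 * (lam ρ + 2*δ) * R ρ δ

/-- Area of the ball-piston collision surface. -/
noncomputable def S (ρ δ : ℝ) : ℝ :=
  (1/(2*Real.sqrt 2))
      * ((lam ρ + 2*δ) * (2 - Real.sqrt (1 - 4*δ*(lam ρ + δ))) - lam ρ)
    + Real.sqrt 2 * ρ^2 * R ρ δ

lemma aux_lam_pos (ρ : ℝ) (h1 : 1/2 < ρ) : 0 < lam ρ := by
  unfold lam
  apply Real.sqrt_pos.mpr
  nlinarith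

lemma aux_lam_sq (ρ : ℝ) (h1 : 1/2 < ρ) : lam ρ ^ 2 = 4*ρ^2 - 1 := by
  unfold lam
  apply Real.sq_sqrt
  nlinarith

lemma aux_lam_lt (ρ : ℝ) (h1 : 1/2 < ρ) (h2 : ρ < 1/Real.sqrt 2) : lam ρ < 1 := by
  have hl := aux_lam_pos ρ h1
  have hs := aux_lam_sq ρ h1
  have h3 : ρ ^ 2 < (1/Real.sqrt 2)^2 := by
    apply pow_lt_pow_left₀ h2 (by linarith) (by norm_num)
  rw [div_pow, Real.sq_sqrt (by norm_num)] at h3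
  nlinarith

lemma aux_A_pos (ρ : ℝ) (h1 : 1/2 < ρ) (h2 : ρ < 1/Real.sqrt 2) : 0 < A ρ := by
  have hl := aux_lam_pos ρ h1
  have hs := aux_lam_sq ρ h1
  have hl1 := aux_lam_lt ρ h1 h2
  unfold A
  set l := lam ρ
  have hy : 0 < (1 - l)/(1 + l) := div_pos (by linarith) (by linarith)
  have hadd : Real.arctan l + Real.arctan ((1-l)/(1+l)) = Real.pi/4 := by
    rw [Real.arctan_add, ← Real.arctan_one]
    · congr 1
      have : 1 + l ≠ 0 := by positivity
      have h4 : 1 - l * ((1-l)/(1+l)) ≠ 0 := by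
        have : 1 - l * ((1-l)/(1+l)) = (1 + l^2)/(1+l) := by field_simp; ring
        rw [this]; positivity
      rw [div_eq_one_iff_eq h4]
      field_simp; ring
    · rw [mul_div_assoc', div_lt_one (by positivity)]
      nlinarith
  have hle : Real.arctan ((1-l)/(1+l)) ≤ (1-l)/(1+l) := by
    have := Real.le_tan (Real.arctan_nonneg.mpr hy.le) (Real.arctan_lt_pi_div_two _)
    rwa [Real.tan_arctan] at this
  have hr : ρ^2 = (1 + l^2)/4 := by linarith
  have e : Real.pi - 4 * Real.arctan l = 4 * Real.arctan ((1-l)/(1+l)) := by linarith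
  rw [e, hr]
  have h5 : (1 + l^2)/4 * (4 * Real.arctan ((1-l)/(1+l))) ≤ (1+l^2) * ((1-l)/(1+l)) := by
    have := mul_le_mul_of_nonneg_left hle (by positivity : 0 ≤ 1 + l^2)
    linarith
  have h6 : (1+l^2) * ((1-l)/(1+l)) < 1 - l := by
    rw [mul_div_assoc', div_lt_iff₀ (by positivity)]
    nlinarith [mul_pos hl (sub_pos.mpr hl1), mul_pos (mul_pos hl (sub_pos.mpr hl1)) (sub_pos.mpr hl1)]
  linarith

lemma aux_hasDeriv (ρ δ : ℝ) (h1 : 1/2 < ρ) (hd : 0 < 1 - 4*δ*(lam ρ + δ)) :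
    HasDerivAt (fun δ => S ρ δ) (Real.sqrt 2 * (1 - Real.sqrt (1 - 4*δ*(lam ρ + δ)))) δ := by
  have hs := aux_lam_sq ρ h1
  unfold S R
  set l := lam ρ
  have hq : HasDerivAt (fun δ : ℝ => 1 - 4*δ*(l + δ)) (-(4*(l+δ) + 4*δ)) δ := by
    have := (((hasDerivAt_id δ).const_mul 4).mul ((hasDerivAt_id δ).const_add l)).const_sub 1
    exact this.congr_deriv (by simp)
  have hu : HasDerivAt (fun δ : ℝ => l + 2*δ) 2 δ := by
    have := ((hasDerivAt_id δ).const_mul 2).const_add l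
    exact this.congr_deriv (by simp)
  have hsq := hq.sqrt hd.ne'
  have hpos : 0 < Real.sqrt (1 - 4*δ*(l+δ)) := Real.sqrt_pos.mpr hd
  have hss : Real.sqrt (1 - 4*δ*(l+δ)) ^ 2 = 1 - 4*δ*(l+δ) := Real.sq_sqrt hd.le
  have hat := ((hu.div hsq hpos.ne').arctan).const_sub (Real.arctan l)
  have hf := (((hu.mul (hsq.const_sub 2)).sub_const l).const_mul (1/(2*Real.sqrt 2))).add
    (hat.const_mul (Real.sqrt 2 * ρ^2))
  refine hf.congr_deriv ?_
  symm
  have h2 : Real.sqrt 2 ^ 2 = 2 := Real.sq_sqrt (by norm_num)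
  have h2p : 0 < Real.sqrt 2 := by positivity
  have hr : ρ^2 = (1 + l^2)/4 := by linarith
  try simp only [Pi.div_apply]
  set s := Real.sqrt (1 - 4*δ*(l+δ))
  set t := Real.sqrt 2
  have e1 : 1/(2*t) = t/4 := by field_simp; linarith
  have e2 : 1 + ((l+2*δ)/s)^2 = (1+l^2)/s^2 := by
    field_simp; rw [hss]; ring
  have hl2 : 0 < 1 + l^2 := by positivity
  rw [e1, e2, hr]
  field_simp
  have h3 : s^3 = s * (1 - 4*δ*(l+δ)) := by rw [← hss]; ring
  ring_nf

/-- In the rare-interaction limit the rescaled inverse ball-piston mean free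
time `(τ_bp·δ²)⁻¹ = S/(4·δ²·G)` converges to `(1/(2√2))·A(ρ)⁻¹`. -/
theorem stmt_4 (ρ : ℝ) (h1 : 1/2 < ρ) (h2 : ρ < 1/Real.sqrt 2) :
    Tendsto (fun δ : ℝ => S ρ δ / (4 * δ^2 * G ρ δ))
      (nhdsWithin 0 (Set.Ioi 0))
      (nhds ((1/(2*Real.sqrt 2))
        * (1 - lam ρ - ρ^2 * (Real.pi - 4 * Real.arctan (lam ρ)))⁻¹)) := by
  have hA := aux_A_pos ρ h1 h2
  have hl := aux_lam_pos ρ h1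
  have hqc : Continuous (fun δ : ℝ => 1 - 4*δ*(lam ρ + δ)) := by fun_prop
  have hev : ∀ᶠ δ in nhds (0:ℝ), 0 < 1 - 4*δ*(lam ρ + δ) :=
    hqc.continuousAt.eventually (lt_mem_nhds (by simp))
  have hev' := hev.filter_mono (nhdsWithin_le_nhds (s := Set.Ioi 0))
  have hG : ContinuousAt (fun δ => G ρ δ) 0 := by
    unfold G R
    have : Real.sqrt (1 - 4*0*(lam ρ + 0)) ≠ 0 := by simp
    fun_prop (disch := assumption)
  have hG0 : G ρ 0 = lam ρ * A ρ := by simp [G, R]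
  have hGt : Tendsto (fun δ => G ρ δ) (nhdsWithin 0 (Set.Ioi 0)) (nhds (lam ρ * A ρ)) := by
    rw [← hG0]
    exact hG.tendsto.mono_left nhdsWithin_le_nhds
  have hS0 : S ρ 0 = 0 := by
    simp [S, R]; ring
  have hL : Tendsto (fun δ => S ρ δ / δ^2) (nhdsWithin 0 (Set.Ioi 0))
      (nhds (Real.sqrt 2 * lam ρ)) := by
    apply HasDerivAt.lhopital_zero_nhdsGT
      (f' := fun δ => Real.sqrt 2 * (1 - Real.sqrt (1 - 4*δ*(lam ρ + δ)))) (g' := fun δ => 2 * δ)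
    · filter_upwards [hev'] with δ hd using aux_hasDeriv ρ δ h1 hd
    · refine Eventually.of_forall fun δ => ?_
      simpa using hasDerivAt_pow 2 δ
    · filter_upwards [self_mem_nhdsWithin] with δ hd
      have : (0:ℝ) < δ := hd
      positivity
    · have := (aux_hasDeriv ρ 0 h1 (by simp)).continuousAt.tendsto
      simp only [hS0] at this
      exact this.mono_left nhdsWithin_le_nhds
    · have : Tendsto (fun δ : ℝ => δ^2) (nhds 0) (nhds (0^2)) := (continuous_pow 2).tendsto 0
      simp only [ne_eq, OfNat.ofNat_ne_zero, not_false_eq_true, zero_pow] at this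
      exact this.mono_left nhdsWithin_le_nhds
    · have hc : Tendsto (fun δ : ℝ => Real.sqrt 2 * (2 * (lam ρ + δ) / (1 + Real.sqrt (1 - 4*δ*(lam ρ + δ)))))
          (nhdsWithin 0 (Set.Ioi 0)) (nhds (Real.sqrt 2 * lam ρ)) := by
        have hh : ContinuousAt (fun δ : ℝ => Real.sqrt 2 * (2 * (lam ρ + δ) / (1 + Real.sqrt (1 - 4*δ*(lam ρ + δ))))) 0 := by
          have : 1 + Real.sqrt (1 - 4*0*(lam ρ + 0)) ≠ 0 := by positivity
          fun_prop (disch := assumption)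
        have := hh.tendsto.mono_left (nhdsWithin_le_nhds (s := Set.Ioi 0))
        convert this using 2
        simp; ring
      refine hc.congr' ?_
      filter_upwards [self_mem_nhdsWithin, hev'] with δ hd hq
      have hd : (0:ℝ) < δ := hd
      have hss := Real.sq_sqrt hq.le
      have hpos := Real.sqrt_nonneg (1 - 4*δ*(lam ρ + δ))
      set s := Real.sqrt (1 - 4*δ*(lam ρ + δ))
      have : 1 + s ≠ 0 := by positivity
      field_simp
      linarith
  have hfin := hL.div (hGt.const_mul 4) (by positivity)
  have hA' : 1 - lam ρ - ρ^2 * (Real.pi - 4 * Real.arctan (lam ρ)) = A ρ := rfl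
  rw [hA']
  have e : Real.sqrt 2 * lam ρ / (4 * (lam ρ * A ρ)) = 1/(2*Real.sqrt 2) * (A ρ)⁻¹ := by
    have h2 : Real.sqrt 2 ^ 2 = 2 := Real.sq_sqrt (by norm_num)
    field_simp
    linarith
  rw [← e]
  refine hfin.congr fun δ => ?_
  simp only [Pi.div_apply]
  rw [div_div]
  congr 1; ring
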